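/- Fix a real number q > 1 and an integer n ≥ 1. There exists a finitely supported c : ℕ × ℕ → ℝ such that vol_{n,0}(x) = Σ_{(a,b)} c(a,b) · q^{a·x} · x^{b} for all integers x ≥ 1 and such that the linear coefficient equals c(0,1) = B_n := n · ∏_{i=1}^{n−1} (1 − q^{i})^{−1}; in particular c(0,1) ≠ 0. -/

import Mathlib

open Finset

noncomputable section

/-- `μ_m := ∏_{i=1}^{m} (1 − q⁻¹)/(1 − q^{-i})`. -/
def mu (q : ℝ) (m : ℕ) : ℝ :=
  ∏ i ∈ Finset.range m, (1 - q⁻¹) / (1 - q ^ (-((i : ℤ) + 1)))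

/-- For a weakly increasing tuple `λ`, the product `∏_j μ_{n_j}` over the lengths
`(n_1, …, n_s)` of the maximal constant segments of `λ` (equivalently, over the
cardinalities of the fibers of `λ`). -/
def typeProd (q : ℝ) {n : ℕ} (l : Fin n → ℤ) : ℝ :=
  ∏ v ∈ Finset.image l Finset.univ, mu q ((Finset.univ.filter fun i => l i = v).card)

/-- The weight `w_n(λ) := ((∏_j μ_{n_j})/μ_n) · ∏_{i<j} q^{λ_j − λ_i}`. -/
def weight (q : ℝ) {n : ℕ} (l : Fin n → ℤ) : ℝ :=
  (typeProd q l / mu q n) *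
    ∏ p ∈ Finset.univ.filter (fun p : Fin n × Fin n => p.1 < p.2), q ^ (l p.2 - l p.1)

open scoped Classical in
/-- The weakly increasing integer tuples `0 ≤ λ_1 ≤ ⋯ ≤ λ_n ≤ x`. -/
def tuples (n x : ℕ) : Finset (Fin n → ℤ) :=
  (Fintype.piFinset fun _ : Fin n => Finset.Icc (0 : ℤ) (x : ℤ)).filter Monotone

/-- `vol_{n,α}(x) := Σ_{0 ≤ λ_1 ≤ ⋯ ≤ λ_n ≤ x} q^{α(λ_1+⋯+λ_n)} · w_n(λ)`
(for `n = 0` this is `1` by convention, the sum being over the single empty tuple). -/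
def vol (q : ℝ) (n : ℕ) (α : ℤ) (x : ℕ) : ℝ :=
  ∑ l ∈ tuples n x, q ^ (α * ∑ i, l i) * weight q l

/-- The Gaussian binomial coefficient `∏_{i=1}^{β} (q^{n−β+i} − 1)/(q^{i} − 1)`. -/
def gaussBinom (q : ℝ) (n β : ℕ) : ℝ :=
  ∏ i ∈ Finset.range β, (q ^ (n - β + i + 1) - 1) / (q ^ (i + 1) - 1)

/-- Evaluation of a finitely supported family of coefficients `c : ℕ × ℕ → ℝ` as the
`q`-quasi-polynomial `x ↦ Σ_{(a,b)} c(a,b) · q^{a·x} · x^{b}`. -/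
def qQuasiEval (q : ℝ) (c : (ℕ × ℕ) →₀ ℝ) (x : ℕ) : ℝ :=
  c.sum fun p r => r * q ^ (p.1 * x) * (x : ℝ) ^ p.2

end


section helpers

/-- Unnormalised Gaussian coefficient in terms of `mu`. -/
noncomputable def GG (q : ℝ) (b m : ℕ) : ℝ := q ^ (b * m) * (mu q b * mu q m / mu q (b + m))

lemma mu_zero' (q : ℝ) : mu q 0 = 1 := by simp [mu]

lemma qpow_ne {q : ℝ} (hq : 1 < q) {k : ℕ} (hk : k ≠ 0) : 1 - q ^ k ≠ 0 := by
  have := one_lt_pow₀ hq hk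
  linarith

lemma mu_succ' {q : ℝ} (hq : 1 < q) (m : ℕ) :
    mu q (m + 1) = mu q m * ((1 - q⁻¹) * q ^ (m + 1) / (q ^ (m + 1) - 1)) := by
  have h := qpow_ne hq (Nat.succ_ne_zero m)
  have h2 : q ^ (m + 1) - 1 ≠ 0 := fun h' => h (by simp only [Nat.succ_eq_add_one]; linarith)
  have hq0 : q ^ (m + 1) ≠ 0 := by positivity
  rw [mu, Finset.prod_range_succ, ← mu]
  congr 1
  have e : q ^ (-((m : ℤ) + 1)) = (q ^ (m + 1))⁻¹ := by
    rw [zpow_neg]; norm_cast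
  rw [e]
  have : 1 - (q ^ (m + 1))⁻¹ = (q ^ (m + 1) - 1) / q ^ (m + 1) := by
    field_simp
  rw [this, div_div_eq_mul_div]

lemma mu_ne {q : ℝ} (hq : 1 < q) (m : ℕ) : mu q m ≠ 0 := by
  induction m with
  | zero => simp [mu_zero']
  | succ m ih =>
    rw [mu_succ' hq]
    have h := qpow_ne hq (Nat.succ_ne_zero m)
    have h2 : q ^ (m + 1) - 1 ≠ 0 := fun h' => h (by simp only [Nat.succ_eq_add_one]; linarith)
    have hq0 : q ^ (m + 1) ≠ 0 := by positivity
    have h3 : 1 - q⁻¹ ≠ 0 := by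
      have := inv_lt_one_of_one_lt₀ hq
      linarith
    exact mul_ne_zero ih (div_ne_zero (mul_ne_zero h3 hq0) h2)

lemma GG_zero_left {q : ℝ} (hq : 1 < q) (m : ℕ) : GG q 0 m = 1 := by
  simp [GG, mu_zero', mu_ne hq]

lemma GG_zero_right {q : ℝ} (hq : 1 < q) (m : ℕ) : GG q m 0 = 1 := by
  simp [GG, mu_zero', mu_ne hq]

lemma GG_succ_right {q : ℝ} (hq : 1 < q) (b m : ℕ) :
    (q ^ (m + 1) - 1) * GG q b (m + 1) = (q ^ (b + m + 1) - 1) * GG q b m := by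
  have h1 := qpow_ne hq (Nat.succ_ne_zero m)
  have h2 : q ^ (m + 1) - 1 ≠ 0 := fun h' => h1 (by simp only [Nat.succ_eq_add_one]; linarith)
  have h1' := qpow_ne hq (Nat.succ_ne_zero (b + m))
  have h2' : q ^ (b + m + 1) - 1 ≠ 0 := fun h' => h1' (by simp only [Nat.succ_eq_add_one]; linarith)
  have h3 : 1 - q⁻¹ ≠ 0 := by
    have := inv_lt_one_of_one_lt₀ hq
    linarith
  have hb := mu_ne hq b
  have hm := mu_ne hq m
  have hbm := mu_ne hq (b + m)
  have hq0 : q ≠ 0 := by positivity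
  unfold GG
  rw [← add_assoc, mu_succ' hq, mu_succ' hq]
  generalize 1 - q⁻¹ = u at *
  field_simp
  ring

lemma GG_symm (q : ℝ) (b m : ℕ) : GG q b m = GG q m b := by
  unfold GG
  rw [mul_comm b m, mul_comm (mu q b), add_comm b m]

lemma GG_succ_left {q : ℝ} (hq : 1 < q) (b m : ℕ) :
    (q ^ (b + 1) - 1) * GG q (b + 1) m = (q ^ (b + m + 1) - 1) * GG q b m := by
  rw [GG_symm, GG_succ_right hq, GG_symm, add_comm m b]

open Finset in
lemma pascal_sum {q : ℝ} (hq : 1 < q) (n : ℕ) (h : ℕ → ℕ → ℝ) :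
    ∑ p ∈ Finset.HasAntidiagonal.antidiagonal (n + 1), GG q p.1 p.2 * h p.1 p.2 =
    ∑ p ∈ Finset.HasAntidiagonal.antidiagonal n, GG q p.1 p.2 * (q ^ p.1 * h p.1 (p.2 + 1) + h (p.1 + 1) p.2) := by
  have h1' := qpow_ne hq (Nat.succ_ne_zero n)
  have h2' : q ^ (n + 1) - 1 ≠ 0 := fun h' => h1' (by simp only [Nat.succ_eq_add_one]; linarith)
  apply mul_left_cancel₀ h2'
  have e : (q ^ (n + 1) - 1) * ∑ p ∈ Finset.HasAntidiagonal.antidiagonal (n + 1), GG q p.1 p.2 * h p.1 p.2 =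
      ∑ p ∈ Finset.HasAntidiagonal.antidiagonal (n + 1), (q ^ p.1 * (q ^ p.2 - 1)) * (GG q p.1 p.2 * h p.1 p.2) +
      ∑ p ∈ Finset.HasAntidiagonal.antidiagonal (n + 1), (q ^ p.1 - 1) * (GG q p.1 p.2 * h p.1 p.2) := by
    rw [mul_sum, ← sum_add_distrib]
    refine sum_congr rfl fun p hp => ?_
    rw [Finset.HasAntidiagonal.mem_antidiagonal] at hp
    rw [← hp, pow_add]; ring
  rw [e, Finset.Nat.sum_antidiagonal_succ', Finset.Nat.sum_antidiagonal_succ]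
  simp only [pow_zero, sub_self, mul_zero, zero_mul, zero_add, add_zero]
  rw [mul_sum, ← sum_add_distrib]
  refine sum_congr rfl fun p hp => ?_
  rw [Finset.HasAntidiagonal.mem_antidiagonal] at hp
  have r := GG_succ_right hq p.1 p.2
  have l := GG_succ_left hq p.1 p.2
  rw [hp] at r l
  linear_combination q ^ p.1 * h p.1 (p.2 + 1) * r + h (p.1 + 1) p.2 * l

open Finset in
lemma identB {q : ℝ} (hq : 1 < q) (z : ℝ) (n : ℕ) :
    ∑ p ∈ Finset.HasAntidiagonal.antidiagonal n, GG q p.1 p.2 * (z ^ p.2 * ∏ i ∈ range p.1, (1 - z * q ^ i)) = 1 := by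
  induction n with
  | zero => simp [GG_zero_left hq]
  | succ n ih =>
    rw [pascal_sum hq n (fun b m => z ^ m * ∏ i ∈ range b, (1 - z * q ^ i))]
    refine Eq.trans ?_ ih
    refine sum_congr rfl fun p hp => ?_
    rw [prod_range_succ]; ring

open Finset in
lemma identA {q : ℝ} (hq : 1 < q) (n : ℕ) :
    ∑ p ∈ Finset.HasAntidiagonal.antidiagonal n, GG q (p.1 + 1) p.2 * ∏ i ∈ range p.1, (1 - q ^ (i + 1)) = n + 1 := by
  let h : ℕ → ℕ → ℝ := fun b _ => if b = 0 then 0 else ∏ i ∈ range (b - 1), (1 - q ^ (i + 1))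
  have key : ∀ n : ℕ, ∑ p ∈ Finset.HasAntidiagonal.antidiagonal n, GG q p.1 p.2 * h p.1 p.2 = n := by
    intro n
    induction n with
    | zero => simp [h]
    | succ n ih =>
      rw [pascal_sum hq n h]
      push_cast
      rw [← ih]
      have e : ∀ p ∈ Finset.HasAntidiagonal.antidiagonal n,
          GG q p.1 p.2 * (q ^ p.1 * h p.1 (p.2 + 1) + h (p.1 + 1) p.2) =
          GG q p.1 p.2 * h p.1 p.2 + (if p = (0, n) then 1 else 0) := by
        rintro ⟨b, m⟩ hp
        rw [Finset.HasAntidiagonal.mem_antidiagonal] at hp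
        rcases b with _ | b
        · simp at hp
          subst hp
          simp [h, GG_zero_left hq]
        · simp only [h, Nat.add_eq_zero_iff, one_ne_zero, and_false, if_false, Nat.add_sub_cancel, prod_range_succ]
          simp
          left
          ring
      rw [sum_congr rfl e, sum_add_distrib, sum_ite_eq']
      simp
  have := key (n + 1)
  rw [Finset.Nat.sum_antidiagonal_succ] at this
  simpa [h] using this

/-! ### Combinatorial recurrence -/

/-- Prepend `b` zeros to the shifted tuple. -/
def extT (b : ℕ) {m : ℕ} (l : Fin m → ℤ) : Fin (b + m) → ℤ :=
  Fin.append (fun _ : Fin b => (0 : ℤ)) (fun j => l j + 1)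

lemma ext_left (b : ℕ) {m : ℕ} (l : Fin m → ℤ) (i : Fin b) : extT b l (Fin.castAdd m i) = 0 := by
  simp [extT]

lemma ext_right (b : ℕ) {m : ℕ} (l : Fin m → ℤ) (i : Fin m) :
    extT b l (Fin.natAdd b i) = l i + 1 := by
  simp [extT]

lemma mem_tuples {n x : ℕ} (l : Fin n → ℤ) :
    l ∈ tuples n x ↔ (∀ i, 0 ≤ l i ∧ l i ≤ x) ∧ Monotone l := by
  simp [tuples, Fintype.mem_piFinset]

lemma typeProd_eq (q : ℝ) {n : ℕ} (l : Fin n → ℤ) (S : Finset ℤ) (hS : ∀ i, l i ∈ S) :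
    typeProd q l = ∏ v ∈ S, mu q ((Finset.univ.filter fun i => l i = v).card) := by
  unfold typeProd
  apply Finset.prod_subset
  · intro v hv
    simp only [Finset.mem_image, Finset.mem_univ, true_and] at hv
    obtain ⟨i, rfl⟩ := hv
    exact hS i
  · intro v _ hv
    have : (Finset.univ.filter fun i => l i = v) = ∅ := by
      ext i
      simp only [Finset.mem_image, Finset.mem_univ, true_and, not_exists] at hv
      simp [hv i]
    rw [this]; simp [mu_zero']

lemma card_ext (b : ℕ) {m : ℕ} (l : Fin m → ℤ) (v : ℤ) :
    (Finset.univ.filter fun i => extT b l i = v).card =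
    (if v = 0 then b else 0) + (Finset.univ.filter fun i => l i + 1 = v).card := by
  rw [Finset.card_filter, Fin.sum_univ_add, Finset.card_filter]
  simp only [ext_left, ext_right]
  congr 1
  by_cases h : v = 0
  · simp [h]
  · simp [h, Ne.symm h]

lemma typeProd_ext (q : ℝ) (b : ℕ) {m : ℕ} (l : Fin m → ℤ) (hl : ∀ i, 0 ≤ l i) :
    typeProd q (extT b l) = mu q b * typeProd q l := by
  have h0 : (0 : ℤ) ∉ (Finset.univ.image l).map (addRightEmbedding 1) := by
    simp only [Finset.mem_map, Finset.mem_image, Finset.mem_univ, true_and, not_exists]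
    rintro v ⟨⟨i, rfl⟩, h⟩
    have := hl i
    simp at h
    omega
  rw [typeProd_eq q (extT b l) (Finset.cons 0 _ h0), Finset.prod_cons, Finset.prod_map, typeProd]
  · congr 1
    · rw [card_ext]
      have : (Finset.univ.filter fun i => l i + 1 = 0) = ∅ := by
        ext i
        have := hl i
        simp
        omega
      simp [this]
    · refine Finset.prod_congr rfl fun v hv => ?_
      simp only [Finset.mem_image, Finset.mem_univ, true_and] at hv
      obtain ⟨i, rfl⟩ := hv
      rw [card_ext]
      have := hl i
      have h' : l i + 1 ≠ 0 := by omega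
      simp [h']
  · intro i
    refine Fin.addCases (fun i => ?_) (fun i => ?_) i
    · simp [ext_left]
    · simp [ext_right]

lemma pairs_ext {q : ℝ} (hq : 1 < q) (b : ℕ) {m : ℕ} (l : Fin m → ℤ) :
    ∏ p ∈ Finset.univ.filter (fun p : Fin (b + m) × Fin (b + m) => p.1 < p.2),
      q ^ (extT b l p.2 - extT b l p.1) =
    q ^ ((b : ℤ) * (∑ i, l i + m)) *
    ∏ p ∈ Finset.univ.filter (fun p : Fin m × Fin m => p.1 < p.2), q ^ (l p.2 - l p.1) := by
  have hq0 : q ≠ 0 := by positivity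
  have hs : ∀ s : Finset (Fin m), ∏ i ∈ s, q ^ (l i + 1) = q ^ (∑ i ∈ s, (l i + 1)) := by
    intro s
    induction s using Finset.induction_on with
    | empty => simp
    | insert a s ha ih => rw [Finset.prod_insert ha, Finset.sum_insert ha, zpow_add₀ hq0 (l a + 1), ih]
  rw [Finset.prod_filter, Finset.prod_filter, ← Finset.univ_product_univ, Finset.prod_product,
    ← Finset.univ_product_univ, Finset.prod_product, Fin.prod_univ_add]
  simp only [Fin.prod_univ_add, ext_left, ext_right]
  congr 1
  · have h1 : ∀ (i : Fin b) (j : Fin m), Fin.castAdd m i < Fin.natAdd b j := by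
      intro i j
      simp [Fin.lt_def]
      omega
    simp only [h1, if_true, sub_self, zpow_zero, ite_self, Finset.prod_const_one, one_mul, sub_zero]
    rw [hs, Finset.prod_const, Finset.card_univ, Fintype.card_fin, ← zpow_natCast, ← zpow_mul,
      Finset.sum_add_distrib]
    congr 1
    simp
    ring
  · have h1 : ∀ (i : Fin b) (j : Fin m), ¬ Fin.natAdd b j < Fin.castAdd m i := by
      intro i j
      simp [Fin.lt_def]
      omega
    simp only [h1, if_false, Finset.prod_const_one, one_mul]
    refine Finset.prod_congr rfl fun i _ => Finset.prod_congr rfl fun j _ => ?_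
    simp

lemma sum_ext (b : ℕ) {m : ℕ} (l : Fin m → ℤ) : ∑ i, extT b l i = ∑ i, l i + m := by
  rw [Fin.sum_univ_add]
  simp [ext_left, ext_right, Finset.sum_add_distrib]

lemma term_ext {q : ℝ} (hq : 1 < q) (α : ℕ) (b : ℕ) {m : ℕ} (l : Fin m → ℤ) (hl : ∀ i, 0 ≤ l i) :
    q ^ ((α : ℤ) * ∑ i, extT b l i) * weight q (extT b l) =
    GG q b m * q ^ (α * m) * (q ^ (((α + b : ℕ) : ℤ) * ∑ i, l i) * weight q l) := by
  have hq0 : q ≠ 0 := by positivity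
  have hm := mu_ne hq m
  have hbm := mu_ne hq (b + m)
  rw [weight, weight, pairs_ext hq, typeProd_ext q b l hl, sum_ext, GG]
  have e1 : q ^ ((α : ℤ) * (∑ i, l i + m)) = q ^ ((α : ℤ) * ∑ i, l i) * q ^ (α * m) := by
    rw [mul_add, zpow_add₀ hq0]; norm_cast
  have e2 : q ^ ((b : ℤ) * (∑ i, l i + m)) = q ^ ((b : ℤ) * ∑ i, l i) * q ^ (b * m) := by
    rw [mul_add, zpow_add₀ hq0]; norm_cast
  have e3 : q ^ (((α + b : ℕ) : ℤ) * ∑ i, l i) =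
      q ^ ((α : ℤ) * ∑ i, l i) * q ^ ((b : ℤ) * ∑ i, l i) := by
    rw [← zpow_add₀ hq0]; push_cast; ring_nf
  rw [e1, e2, e3]
  field_simp

lemma zeros_char {n b : ℕ} (l : Fin n → ℤ) (hl : Monotone l) (h0 : ∀ i, 0 ≤ l i)
    (hc : (Finset.univ.filter fun i => l i = 0).card = b) (i : Fin n) : l i = 0 ↔ i.val < b := by
  constructor
  · intro hi
    have : Finset.Iic i ⊆ Finset.univ.filter fun i => l i = 0 := by
      intro j hj
      rw [Finset.mem_Iic] at hj
      have := hl hj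
      have := h0 j
      simp
      omega
    have := Finset.card_le_card this
    rw [Fin.card_Iic] at this
    omega
  · intro hi
    by_contra hne
    have : (Finset.univ.filter fun i => l i = 0) ⊆ Finset.Iio i := by
      intro j hj
      simp at hj
      rw [Finset.mem_Iio]
      by_contra hji
      have := hl (not_lt.mp hji)
      have := h0 i
      omega
    have := Finset.card_le_card this
    rw [Fin.card_Iio] at this
    omega

lemma fiber_sum (b m x : ℕ) (f : (Fin (b + m) → ℤ) → ℝ) :
    ∑ l ∈ (tuples (b + m) (x + 1)).filter
      (fun l => (Finset.univ.filter fun i => l i = 0).card = b), f l =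
    ∑ l ∈ tuples m x, f (extT b l) := by
  symm
  refine Finset.sum_bij' (fun l _ => extT b l) (fun l _ j => l (Fin.natAdd b j) - 1) ?_ ?_ ?_ ?_ ?_
  · intro l hl
    rw [mem_tuples] at hl
    rw [Finset.mem_filter, mem_tuples]
    refine ⟨⟨?_, ?_⟩, ?_⟩
    · intro i
      refine Fin.addCases (fun i => ?_) (fun i => ?_) i
      · rw [ext_left]; constructor <;> positivity
      · rw [ext_right]
        have := hl.1 i
        push_cast
        constructor <;> linarith
    · intro i j
      refine Fin.addCases (fun i => ?_) (fun i => ?_) i <;>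
      refine Fin.addCases (fun j => ?_) (fun j => ?_) j <;> intro hij
      · simp [ext_left]
      · rw [ext_left, ext_right]
        have := hl.1 j
        linarith
      · exfalso
        simp [Fin.le_def] at hij
        omega
      · rw [ext_right, ext_right]
        have : i ≤ j := by simpa using hij
        have := hl.2 this
        linarith
    · rw [card_ext]
      have : (Finset.univ.filter fun i => l i + 1 = 0) = ∅ := by
        ext i
        have := hl.1 i
        simp
        omega
      simp [this]
  · intro l hl
    rw [Finset.mem_filter, mem_tuples] at hl
    obtain ⟨⟨h1, h2⟩, h3⟩ := hl
    have hz := zeros_char l h2 (fun i => (h1 i).1) h3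
    rw [mem_tuples]
    constructor
    · intro i
      have h4 := h1 (Fin.natAdd b i)
      have h5 : l (Fin.natAdd b i) ≠ 0 := by
        rw [Ne, hz]; simp
      push_cast at h4
      omega
    · intro i j hij
      have : Fin.natAdd b i ≤ Fin.natAdd b j := by simpa using hij
      have := h2 this
      simpa using this
  · intro l _
    funext j
    simp [ext_right]
  · intro l hl
    rw [Finset.mem_filter, mem_tuples] at hl
    obtain ⟨⟨h1, h2⟩, h3⟩ := hl
    have hz := zeros_char l h2 (fun i => (h1 i).1) h3
    funext i
    refine Fin.addCases (fun i => ?_) (fun i => ?_) i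
    · rw [ext_left]
      symm
      rw [hz]; simp
    · rw [ext_right]; ring
  · intro l _
    rfl

lemma vol_rec {q : ℝ} (hq : 1 < q) (n α x : ℕ) :
    vol q n α (x + 1) = ∑ p ∈ Finset.HasAntidiagonal.antidiagonal n,
      GG q p.1 p.2 * q ^ (α * p.2) * vol q p.2 ((α + p.1 : ℕ) : ℤ) x := by
  rw [Finset.Nat.sum_antidiagonal_eq_sum_range_succ_mk]
  have hmaps : ∀ l ∈ tuples n (x + 1),
      (Finset.univ.filter fun i => l i = 0).card ∈ Finset.range (n + 1) := by
    intro l _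
    rw [Finset.mem_range, Nat.lt_succ_iff]
    exact (Finset.card_le_univ _).trans (by simp)
  rw [vol, ← Finset.sum_fiberwise_of_maps_to hmaps]
  refine Finset.sum_congr rfl fun b hb => ?_
  obtain ⟨m, rfl⟩ : ∃ m, n = b + m := ⟨n - b, by rw [Finset.mem_range] at hb; omega⟩
  rw [fiber_sum]
  simp only [Nat.add_sub_cancel_left]
  rw [vol, Finset.mul_sum]
  refine Finset.sum_congr rfl fun l hl => ?_
  rw [mem_tuples] at hl
  exact term_ext hq α b l (fun i => (hl.1 i).1)

/-! ### Quasi-polynomials without constant exponential part -/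

/-- basis functions -/
noncomputable def bas (q : ℝ) (p : ℕ × ℕ) : ℕ → ℝ := fun x => q ^ ((p.1 + 1) * x) * (x : ℝ) ^ p.2

/-- span of `q^{ax} x^b`, `a ≥ 1`. -/
noncomputable def VV (q : ℝ) : Submodule ℝ (ℕ → ℝ) := Submodule.span ℝ (Set.range (bas q))

/-- the operator `f ↦ f(x+1) - q^k f(x)` -/
noncomputable def TT (q : ℝ) (k : ℕ) : (ℕ → ℝ) →ₗ[ℝ] (ℕ → ℝ) where
  toFun f x := f (x + 1) - q ^ k * f x
  map_add' f g := by funext x; simp; ring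
  map_smul' r f := by funext x; simp; ring

lemma bas_mem (q : ℝ) (a b : ℕ) : bas q (a, b) ∈ VV q := Submodule.subset_span ⟨_, rfl⟩

lemma add_one_pow (y : ℝ) (b : ℕ) :
    (y + 1) ^ b = y ^ b + ∑ i ∈ Finset.range b, (b.choose i : ℝ) * y ^ i := by
  rw [add_pow, Finset.sum_range_succ]
  simp
  rw [add_comm]
  congr 1
  exact Finset.sum_congr rfl fun i _ => by ring

lemma bas_surj {q : ℝ} (hq : 1 < q) (k a b : ℕ) : bas q (a, b) ∈ (VV q).map (TT q k) := by
  have hq0 : q ≠ 0 := by positivity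
  induction b using Nat.strong_induction_on with
  | _ b ih =>
    by_cases hak : a + 1 = k
    · have hT : TT q k (bas q (a, b + 1)) =
          (q ^ k * (b + 1)) • bas q (a, b) +
          ∑ i ∈ Finset.range b, (q ^ k * ((b + 1).choose i : ℝ)) • bas q (a, i) := by
        funext x
        simp only [TT, bas, LinearMap.coe_mk, AddHom.coe_mk, Pi.add_apply, Pi.smul_apply,
          Finset.sum_apply, smul_eq_mul, hak]
        push_cast
        rw [add_one_pow, Finset.sum_range_succ, Nat.choose_succ_self_right, mul_add k, pow_add]
        have : ∑ i ∈ Finset.range b, q ^ k * ((b + 1).choose i : ℝ) * (q ^ (k * x) * (x : ℝ) ^ i) =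
            q ^ k * q ^ (k * x) * ∑ i ∈ Finset.range b, ((b + 1).choose i : ℝ) * (x : ℝ) ^ i := by
          rw [Finset.mul_sum]
          exact Finset.sum_congr rfl fun i _ => by ring
        rw [this]
        push_cast
        ring
      have hne : q ^ k * ((b : ℝ) + 1) ≠ 0 := by positivity
      rw [← Submodule.smul_mem_iff _ hne]
      have : (q ^ k * ((b : ℝ) + 1)) • bas q (a, b) = TT q k (bas q (a, b + 1)) -
          ∑ i ∈ Finset.range b, (q ^ k * ((b + 1).choose i : ℝ)) • bas q (a, i) := by
        rw [hT]; simp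
      rw [this]
      refine Submodule.sub_mem _ (Submodule.mem_map_of_mem (bas_mem _ _ _))
        (Submodule.sum_mem _ fun i hi => Submodule.smul_mem _ _ (ih i (Finset.mem_range.mp hi)))
    · have hT : TT q k (bas q (a, b)) =
          (q ^ (a + 1) - q ^ k) • bas q (a, b) +
          ∑ i ∈ Finset.range b, (q ^ (a + 1) * (b.choose i : ℝ)) • bas q (a, i) := by
        funext x
        simp only [TT, bas, LinearMap.coe_mk, AddHom.coe_mk, Pi.add_apply, Pi.smul_apply,
          Finset.sum_apply, smul_eq_mul]
        push_cast
        rw [add_one_pow, mul_add (a + 1), pow_add, mul_one]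
        have : ∑ i ∈ Finset.range b,
            q ^ (a + 1) * (b.choose i : ℝ) * (q ^ ((a + 1) * x) * (x : ℝ) ^ i) =
            q ^ (a + 1) * q ^ ((a + 1) * x) *
              ∑ i ∈ Finset.range b, (b.choose i : ℝ) * (x : ℝ) ^ i := by
          rw [Finset.mul_sum]
          exact Finset.sum_congr rfl fun i _ => by ring
        rw [this]
        ring
      have hne : q ^ (a + 1) - q ^ k ≠ 0 := by
        rw [sub_ne_zero]
        exact fun h => hak (pow_right_injective₀ (by positivity) hq.ne' h)
      rw [← Submodule.smul_mem_iff _ hne]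
      have : (q ^ (a + 1) - q ^ k) • bas q (a, b) = TT q k (bas q (a, b)) -
          ∑ i ∈ Finset.range b, (q ^ (a + 1) * (b.choose i : ℝ)) • bas q (a, i) := by
        rw [hT]; simp
      rw [this]
      refine Submodule.sub_mem _ (Submodule.mem_map_of_mem (bas_mem _ _ _))
        (Submodule.sum_mem _ fun i hi => Submodule.smul_mem _ _ (ih i (Finset.mem_range.mp hi)))

lemma solve {q : ℝ} (hq : 1 < q) (k : ℕ) (f : ℕ → ℝ) (hf : TT q k f ∈ VV q) :
    ∃ c : ℝ, (fun x => f x - c * q ^ (k * x)) ∈ VV q := by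
  have hle : VV q ≤ (VV q).map (TT q k) := by
    unfold VV
    rw [Submodule.span_le]
    rintro _ ⟨⟨a, b⟩, rfl⟩
    exact bas_surj hq k a b
  obtain ⟨h, hh, hT⟩ := hle hf
  refine ⟨f 0 - h 0, ?_⟩
  have : (fun x => f x - (f 0 - h 0) * q ^ (k * x)) = h := by
    funext x
    induction x with
    | zero => simp
    | succ x ih =>
      have := congrFun hT x
      simp only [TT, LinearMap.coe_mk, AddHom.coe_mk] at this
      rw [mul_add, mul_one, pow_add]
      linear_combination -this + q ^ k * ih
  rw [this]; exact hh

lemma solve_pos {q : ℝ} (hq : 1 < q) (k : ℕ) (hk : k ≠ 0) (f : ℕ → ℝ) (hf : TT q k f ∈ VV q) :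
    f ∈ VV q := by
  obtain ⟨c, hc⟩ := solve hq k f hf
  obtain ⟨j, rfl⟩ := Nat.exists_eq_succ_of_ne_zero hk
  have := Submodule.add_mem _ hc (Submodule.smul_mem _ c (bas_mem q j 0))
  convert this using 1
  funext x
  simp [bas]

/-- constant coefficient of `vol_{m,α}` -/
noncomputable def CC (q : ℝ) (m α : ℕ) : ℝ := ∏ i ∈ Finset.range m, (1 - q ^ (α + i))⁻¹

lemma vol_zero_dim (q : ℝ) (α : ℤ) (x : ℕ) : vol q 0 α x = 1 := by
  have : tuples 0 x = {Fin.elim0} := by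
    ext l
    simp only [mem_tuples, Finset.mem_singleton]
    constructor
    · intro _; exact Subsingleton.elim _ _
    · intro _; exact ⟨fun i => i.elim0, fun i => i.elim0⟩
  rw [vol, this]
  simp [weight, typeProd, mu_zero']

open Finset in
lemma CC_split {q : ℝ} (hq : 1 < q) (α b m : ℕ) (hα : α ≠ 0) :
    CC q m (α + b) = CC q (b + m) α * ∏ i ∈ range b, (1 - q ^ (α + i)) := by
  have hne : ∏ i ∈ range b, (1 - q ^ (α + i)) ≠ 0 :=
    prod_ne_zero_iff.mpr fun i _ => qpow_ne hq (by omega)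
  unfold CC
  rw [prod_range_add, mul_comm (∏ i ∈ range b, _) (∏ i ∈ range m, _), mul_assoc,
    ← prod_mul_distrib]
  rw [prod_congr (s₁ := range b) rfl (fun i _ => inv_mul_cancel₀ (qpow_ne hq (by omega)))]
  simp [add_assoc]

/-- inhomogeneous constant term -/
noncomputable def KK (q : ℝ) (n α : ℕ) : ℝ := ∑ p ∈ Finset.HasAntidiagonal.antidiagonal n,
  GG q (p.1 + 1) p.2 * q ^ (α * p.2) * CC q p.2 (α + (p.1 + 1))

open Finset in
lemma KK_pos {q : ℝ} (hq : 1 < q) (n α : ℕ) (hα : α ≠ 0) :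
    KK q n α = CC q (n + 1) α * (1 - q ^ (α * (n + 1))) := by
  have h := identB hq (q ^ α) (n + 1)
  rw [Finset.Nat.sum_antidiagonal_succ] at h
  simp only [GG_zero_left hq, range_zero, prod_empty, mul_one, one_mul, ← pow_mul] at h
  rw [← eq_sub_iff_add_eq'] at h
  rw [← h, mul_sum, KK]
  refine sum_congr rfl fun p hp => ?_
  rw [Finset.HasAntidiagonal.mem_antidiagonal] at hp
  rw [CC_split hq α (p.1 + 1) p.2 hα, show p.1 + 1 + p.2 = n + 1 by omega]
  simp only [pow_add]
  ring

open Finset in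
lemma KK_zero {q : ℝ} (hq : 1 < q) (n : ℕ) :
    KK q n 0 = ((n : ℝ) + 1) * CC q n 1 := by
  rw [← identA hq n, sum_mul, KK]
  refine sum_congr rfl fun p hp => ?_
  rw [Finset.HasAntidiagonal.mem_antidiagonal] at hp
  rw [show 0 + (p.1 + 1) = 1 + p.1 by ring, CC_split hq 1 p.1 p.2 one_ne_zero, hp]
  simp only [add_comm 1]
  simp
  ring

lemma TT_vol {q : ℝ} (hq : 1 < q) (n α : ℕ)
    (ih : ∀ m ≤ n, ∀ β : ℕ, β ≠ 0 → (fun x => vol q m β x - CC q m β) ∈ VV q) :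
    (fun x => TT q (α * (n + 1)) (fun x => vol q (n + 1) α x) x - KK q n α) ∈ VV q := by
  have : (fun x => TT q (α * (n + 1)) (fun x => vol q (n + 1) α x) x - KK q n α) =
      ∑ p ∈ Finset.HasAntidiagonal.antidiagonal n, (GG q (p.1 + 1) p.2 * q ^ (α * p.2)) •
        (fun x => vol q p.2 ((α + (p.1 + 1) : ℕ) : ℤ) x - CC q p.2 (α + (p.1 + 1))) := by
    funext x
    simp only [TT, LinearMap.coe_mk, AddHom.coe_mk, Finset.sum_apply, Pi.smul_apply, smul_eq_mul,
      mul_sub, Finset.sum_sub_distrib]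
    rw [vol_rec hq, Finset.Nat.sum_antidiagonal_succ, GG_zero_left hq, KK]
    simp
  rw [this]
  refine Submodule.sum_mem _ fun p hp => Submodule.smul_mem _ _ (ih _ ?_ _ ?_)
  · rw [Finset.HasAntidiagonal.mem_antidiagonal] at hp; omega
  · omega

lemma vol_pos {q : ℝ} (hq : 1 < q) (m : ℕ) : ∀ α : ℕ, α ≠ 0 →
    (fun x => vol q m α x - CC q m α) ∈ VV q := by
  induction m using Nat.strong_induction_on with
  | _ m ih =>
    intro α hα
    rcases m with _ | n
    · have : (fun x => vol q 0 α x - CC q 0 α) = 0 := by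
        funext x; simp [vol_zero_dim, CC]
      rw [this]; exact Submodule.zero_mem _
    · apply solve_pos hq (α * (n + 1)) (by positivity)
      have h := TT_vol hq n α (fun m hm => ih m (by omega))
      convert h using 1
      funext x
      rw [KK_pos hq n α hα]
      simp only [TT, LinearMap.coe_mk, AddHom.coe_mk]
      ring

end helpers

/-- **Linear coefficient of `vol_{n,0}`.** For `q > 1` and `n ≥ 1`, the function
`x ↦ vol_{n,0}(x)` admits a `q`-quasi-polynomial expansion whose linear coefficient equals
`B_n := n · ∏_{i=1}^{n−1} (1 − q^{i})⁻¹`; in particular this coefficient is nonzero. -/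
theorem vol_linear_coeff (q : ℝ) (hq : 1 < q) (n : ℕ) (hn : 1 ≤ n) :
    ∃ c : (ℕ × ℕ) →₀ ℝ,
      (∀ x : ℕ, 1 ≤ x → vol q n 0 x = qQuasiEval q c x) ∧
      c (0, 1) = (n : ℝ) * ∏ i ∈ Finset.Ico 1 n, (1 - q ^ i)⁻¹ ∧
      c (0, 1) ≠ 0 := by
  obtain ⟨n, rfl⟩ : ∃ m, n = m + 1 := ⟨n - 1, by omega⟩
  set B : ℝ := ((n + 1 : ℕ) : ℝ) * ∏ i ∈ Finset.Ico 1 (n + 1), (1 - q ^ i)⁻¹ with hB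
  have hB0 : B ≠ 0 := by
    refine mul_ne_zero (by positivity) (Finset.prod_ne_zero_iff.mpr fun i hi => ?_)
    rw [Finset.mem_Ico] at hi
    exact inv_ne_zero (qpow_ne hq (by omega))
  have hK : KK q n 0 = B := by
    rw [KK_zero hq, hB, CC, Finset.prod_Ico_eq_prod_range]
    simp
  have h1 := TT_vol hq n 0 (fun m _ => vol_pos hq m)
  rw [hK] at h1
  have h2 : TT q 0 (fun x => vol q (n + 1) 0 x - B * x) ∈ VV q := by
    convert h1 using 1
    funext x
    simp [TT]
    ring
  obtain ⟨c0, hc0⟩ := solve hq 0 _ h2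
  obtain ⟨c', hc'⟩ := (Finsupp.mem_span_range_iff_exists_finsupp).mp hc0
  let e : ℕ × ℕ → ℕ × ℕ := fun p => (p.1 + 1, p.2)
  have hmd : Finsupp.mapDomain e c' (0, 1) = 0 := by
    apply Finsupp.mapDomain_of_notMem_range
    rintro ⟨p, hp⟩
    simp [e] at hp
  have hval : (Finsupp.mapDomain e c' + Finsupp.single (0, 1) B + Finsupp.single (0, 0) c0 :
      (ℕ × ℕ) →₀ ℝ) (0, 1) = B := by
    simp [hmd]
  refine ⟨Finsupp.mapDomain e c' + Finsupp.single (0, 1) B + Finsupp.single (0, 0) c0,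
    ?_, hval, by rw [hval]; exact hB0⟩
  intro x _
  have h3 := congrFun hc' x
  unfold qQuasiEval
  rw [Finsupp.sum_add_index' (by simp) (by intros; ring),
    Finsupp.sum_add_index' (by simp) (by intros; ring),
    Finsupp.sum_single_index (by simp), Finsupp.sum_single_index (by simp),
    Finsupp.sum_mapDomain_index (by simp) (by intros; ring)]
  have h4 : (c'.sum fun i a => a • bas q i) x =
      c'.sum fun p r => r * q ^ ((e p).1 * x) * (x : ℝ) ^ (e p).2 := by
    simp only [Finsupp.sum, Finset.sum_apply, Pi.smul_apply, smul_eq_mul, bas, e, mul_assoc]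
  rw [h4] at h3
  rw [h3]
  simp
  ring
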